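/- Let L, L_r, L_s, Σ, Q be a normed continuous-time Markov game structure, fix t ∈ ℝ and 0 < ε ≤ 1, and let x : L → ℝ satisfy x(l) ∈ [0,1] for all l. Let f : L → ℝ → ℝ solve the Bellman equations on [t−ε, t] with terminal value x and take values in [0,1] on [t−ε,t], and let p1 be a single ε-net approximation from x. Then for every l ∈ L and every τ ∈ [0, ε], the difference between the derivative of f(l,·) at t−τ and the derivative of p1(l,·) at t−τ has absolute value at most 2τ. -/

import Mathlib

/-- A normed continuous-time Markov game structure: a finite nonempty set `L` of
locations partitioned into reachability locations (`isReach l = true`) and safety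
locations (`isReach l = false`), a finite set `A` of actions with a nonempty set
`enabled l` of enabled actions at each location, and a rate matrix `R` whose rows
(for enabled actions) are probability distributions on `L`. -/
structure NCTMG (L A : Type) [Fintype L] [DecidableEq L] [Fintype A] where
  isReach : L → Bool
  enabled : L → Finset A
  enabled_nonempty : ∀ l, (enabled l).Nonempty
  R : L → A → L → ℝ
  R_nonneg : ∀ l a l', a ∈ enabled l → 0 ≤ R l a l'
  R_sum : ∀ l a, a ∈ enabled l → (∑ l', R l a l') = 1

namespace NCTMG

variable {L A : Type} [Fintype L] [DecidableEq L] [Fintype A]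

/-- The generator `Q(l,a,l') = R(l,a,l') − δ_{l,l'}`. -/
def Q (M : NCTMG L A) (l : L) (a : A) (l' : L) : ℝ :=
  M.R l a l' - (if l = l' then 1 else 0)

/-- `opt_l`: maximum over enabled actions at reachability locations, minimum
over enabled actions at safety locations. -/
noncomputable def opt (M : NCTMG L A) (l : L) (v : A → ℝ) : ℝ :=
  if M.isReach l then (M.enabled l).sup' (M.enabled_nonempty l) v
  else (M.enabled l).inf' (M.enabled_nonempty l) v

/-- `f` solves the Bellman equations on `[t−ε, t]` with terminal value `x`. -/
def SolvesBellman (M : NCTMG L A) (t ε : ℝ) (x : L → ℝ) (f : L → ℝ → ℝ) : Prop :=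
  (∀ l, f l t = x l) ∧
  ∀ l, ∀ τ ∈ Set.Icc (t - ε) t,
    HasDerivAt (f l) (-(M.opt l (fun a => ∑ l', M.Q l a l' * f l' τ))) τ

/-- `p1` is a single `ε`-net approximation from terminal value `x` with chosen
actions `act`: each `act l` is enabled and attains `opt_l` of `∑ Q(l,a,·)·x`,
and `p1(l, t−τ) = x(l) + τ·c_l` on `[0,ε]` where `c_l = ∑ Q(l,act l,·)·x`. -/
def IsSingleNet (M : NCTMG L A) (t ε : ℝ) (x : L → ℝ) (act : L → A)
    (p1 : L → ℝ → ℝ) : Prop :=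
  (∀ l, act l ∈ M.enabled l) ∧
  (∀ l, (∑ l', M.Q l (act l) l' * x l') =
      M.opt l (fun a => ∑ l', M.Q l a l' * x l')) ∧
  (∀ l, ∀ τ ∈ Set.Icc (0 : ℝ) ε,
      p1 l (t - τ) = x l + τ * (∑ l', M.Q l (act l) l' * x l'))

end NCTMG

/-- The sup-norm `‖v‖ = max_{l∈L} |v l|` on functions `L → ℝ`. -/
noncomputable def supNorm {L : Type} [Fintype L] [Nonempty L] (v : L → ℝ) : ℝ :=
  Finset.univ.sup' Finset.univ_nonempty (fun l => |v l|)

namespace NCTMG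

variable {L A : Type} [Fintype L] [DecidableEq L] [Fintype A]

theorem exists_opt_eq (M : NCTMG L A) (l : L) (v : A → ℝ) :
    ∃ a ∈ M.enabled l, M.opt l v = v a := by
  unfold opt
  split_ifs
  · exact Finset.exists_mem_eq_sup' _ v
  · exact Finset.exists_mem_eq_inf' _ v

theorem opt_le_opt_add (M : NCTMG L A) (l : L) {v w : A → ℝ} {c : ℝ}
    (h : ∀ a ∈ M.enabled l, v a ≤ w a + c) : M.opt l v ≤ M.opt l w + c := by
  unfold opt
  split_ifs
  · exact Finset.sup'_le _ _ fun a ha =>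
      (h a ha).trans (add_le_add_left (Finset.le_sup' w ha) c)
  · obtain ⟨a, ha, hw⟩ := Finset.exists_mem_eq_inf' (M.enabled_nonempty l) w
    rw [hw]
    exact (Finset.inf'_le v ha).trans (h a ha)

theorem abs_opt_sub_opt_le (M : NCTMG L A) (l : L) {v w : A → ℝ} {c : ℝ}
    (h : ∀ a ∈ M.enabled l, |v a - w a| ≤ c) : |M.opt l v - M.opt l w| ≤ c := by
  have h₁ : M.opt l v ≤ M.opt l w + c :=
    M.opt_le_opt_add l fun a ha => by linarith [(abs_le.1 (h a ha)).2]
  have h₂ : M.opt l w ≤ M.opt l v + c :=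
    M.opt_le_opt_add l fun a ha => by linarith [(abs_le.1 (h a ha)).1]
  exact abs_le.2 ⟨by linarith, by linarith⟩

theorem sum_Q_mul (M : NCTMG L A) (l : L) (a : A) (v : L → ℝ) :
    ∑ l', M.Q l a l' * v l' = (∑ l', M.R l a l' * v l') - v l := by
  simp [Q, sub_mul, Finset.sum_sub_distrib]

theorem sum_R_mul_mem_Icc (M : NCTMG L A) {l : L} {a : A} (ha : a ∈ M.enabled l)
    {v : L → ℝ} {b c : ℝ} (hv : ∀ l', v l' ∈ Set.Icc b c) :
    ∑ l', M.R l a l' * v l' ∈ Set.Icc b c := by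
  simpa using (convex_Icc b c).sum_mem (t := Finset.univ) (w := M.R l a) (z := v)
    (fun l' _ => M.R_nonneg l a l' ha) (M.R_sum l a ha) (fun l' _ => hv l')

theorem abs_sum_Q_mul_le_of_mem_Icc (M : NCTMG L A) {l : L} {a : A}
    (ha : a ∈ M.enabled l) {v : L → ℝ} {b c : ℝ} (hv : ∀ l', v l' ∈ Set.Icc b c) :
    |∑ l', M.Q l a l' * v l'| ≤ c - b := by
  have hR := M.sum_R_mul_mem_Icc ha hv
  have hl := hv l
  rw [sum_Q_mul]
  exact abs_le.2 ⟨by linarith [hR.1, hl.2], by linarith [hR.2, hl.1]⟩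

/-- A `[0,1]`-valued solution of the Bellman equations moves by at most `τ` within time `τ`
of the terminal time. -/
theorem SolvesBellman.abs_sub_terminal_le {M : NCTMG L A} {t ε : ℝ} {x : L → ℝ}
    {f : L → ℝ → ℝ} (hf : M.SolvesBellman t ε x f)
    (hf01 : ∀ l, ∀ τ ∈ Set.Icc (t - ε) t, f l τ ∈ Set.Icc (0 : ℝ) 1)
    (l : L) {τ : ℝ} (hτ : τ ∈ Set.Icc 0 ε) : |f l (t - τ) - x l| ≤ τ := by
  have hbound : ∀ s ∈ Set.Icc (t - ε) t,
      ‖-(M.opt l (fun a => ∑ l', M.Q l a l' * f l' s))‖ ≤ 1 := by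
    intro s hs
    obtain ⟨a, ha, h⟩ := M.exists_opt_eq l (fun a => ∑ l', M.Q l a l' * f l' s)
    rw [h, norm_neg, Real.norm_eq_abs]
    simpa using M.abs_sum_Q_mul_le_of_mem_Icc ha fun l' => hf01 l' s hs
  have := (convex_Icc (t - ε) t).norm_image_sub_le_of_norm_hasDerivWithin_le
    (fun s hs => (hf.2 l s hs).hasDerivWithinAt) hbound
    (Set.right_mem_Icc.2 (by linarith [hτ.1, hτ.2]) : t ∈ Set.Icc (t - ε) t)
    (⟨by linarith [hτ.2], by linarith [hτ.1]⟩ : t - τ ∈ Set.Icc (t - ε) t)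
  simpa [hf.1 l, Real.norm_eq_abs, abs_of_nonneg hτ.1] using this

end NCTMG

/-- the derivative of the Bellman solution and the derivative
`−c_l` of the single ε-net approximation differ by at most `2τ` at time `t−τ`. -/
theorem single_net_deriv_error {L A : Type} [Fintype L] [DecidableEq L]
    [Nonempty L] [Fintype A] (M : NCTMG L A) (t ε : ℝ) (hε0 : 0 < ε)
    (hε1 : ε ≤ 1)
    (x : L → ℝ) (hx : ∀ l, x l ∈ Set.Icc (0 : ℝ) 1)
    (f : L → ℝ → ℝ) (hf : M.SolvesBellman t ε x f)
    (hf01 : ∀ l, ∀ τ ∈ Set.Icc (t - ε) t, f l τ ∈ Set.Icc (0 : ℝ) 1)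
    (act : L → A) (p1 : L → ℝ → ℝ) (hp1 : M.IsSingleNet t ε x act p1) :
    ∀ l, ∀ τ ∈ Set.Icc (0 : ℝ) ε,
      |deriv (f l) (t - τ) - (-(∑ l', M.Q l (act l) l' * x l'))| ≤ 2 * τ := by
  intro l τ hτ
  have hmem : t - τ ∈ Set.Icc (t - ε) t := ⟨by linarith [hτ.2], by linarith [hτ.1]⟩
  rw [(hf.2 l _ hmem).deriv, hp1.2.1 l, neg_sub_neg, abs_sub_comm]
  refine M.abs_opt_sub_opt_le l fun a ha => ?_
  have h := M.abs_sum_Q_mul_le_of_mem_Icc ha (v := fun l' => f l' (t - τ) - x l')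
    fun l' => abs_le.1 (hf.abs_sub_terminal_le hf01 l' hτ)
  simp only [mul_sub, Finset.sum_sub_distrib] at h
  linarith
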